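/- For every ε ∈ (0,1], the inequality (e^ε + ε² − 1)/(1+ε) > (1+ε)(1 − e^{−ε}) holds. -/

import Mathlib

open Real

/-- For every ε ∈ (0,1], (e^ε + ε² − 1)/(1+ε) > (1+ε)(1 − e^{−ε}). -/
theorem stmt_14 (ε : ℝ) (hε : ε ∈ Set.Ioc (0 : ℝ) 1) :
    (Real.exp ε + ε ^ 2 - 1) / (1 + ε) > (1 + ε) * (1 - Real.exp (-ε)) := by
  obtain ⟨h0, h1⟩ := hε
  have hy : ε + 1 < Real.exp ε := Real.add_one_lt_exp h0.ne'
  have hp : 0 < Real.exp ε := Real.exp_pos ε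
  have key : (Real.exp ε + ε ^ 2 - 1) / (1 + ε) - (1 + ε) * (1 - Real.exp (-ε))
      = (Real.exp ε - (ε + 1)) ^ 2 / ((1 + ε) * Real.exp ε) := by
    rw [Real.exp_neg]
    have h2 : (1 + ε) ≠ 0 := by positivity
    field_simp
    ring
  have hpos : 0 < (Real.exp ε - (ε + 1)) ^ 2 / ((1 + ε) * Real.exp ε) := by
    have h3 : 0 < Real.exp ε - (ε + 1) := by linarith
    positivity
  linarith
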